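/- arXiv:1803.01186 — 14 statements merged into one kernel-verified Lean document; each statement's English description precedes it below -/
import Mathlib

section
/- Let V : ℝ → ℝ be continuous, let E, E_m ∈ ℝ with E_m < E, and let y ≤ x. Let ψ : ℝ → ℝ satisfy the Schrödinger equation with potential V and energy E on [y,x]. Define g(t) := ψ(t)² + ψ'(t)²/(E−E_m). Then g(x) ≤ g(y) · exp( (1/√(E−E_m)) ∫_y^x |V(t) − E_m| dt ). -/
/-- **Davies' growth bound.** If `E_m < E`, `y ≤ x`, and `ψ` satisfies the Schrödinger
equation `-ψ'' + Vψ = Eψ` on `[y,x]` (twice continuously differentiable there), then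
with `g(t) = ψ(t)² + ψ'(t)²/(E-E_m)`,
`g(x) ≤ g(y) · exp((1/√(E-E_m)) ∫_y^x |V(t) - E_m| dt)`. -/
theorem stmt_1
    (V ψ ψ' ψ'' : ℝ → ℝ) (E Em y x : ℝ)
    (hV : Continuous V) (hE : Em < E) (hyx : y ≤ x)
    (hψ : ∀ t ∈ Set.Icc y x, HasDerivAt ψ (ψ' t) t)
    (hψ' : ∀ t ∈ Set.Icc y x, HasDerivAt ψ' (ψ'' t) t)
    (hψ''c : ContinuousOn ψ'' (Set.Icc y x))
    (heq : ∀ t ∈ Set.Icc y x, -ψ'' t + V t * ψ t = E * ψ t) :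
    ψ x ^ 2 + ψ' x ^ 2 / (E - Em) ≤
      (ψ y ^ 2 + ψ' y ^ 2 / (E - Em)) *
        Real.exp ((1 / Real.sqrt (E - Em)) * ∫ t in y..x, |V t - Em|) := by
  have hd : 0 < E - Em := sub_pos.mpr hE
  set k := Real.sqrt (E - Em) with hk
  have hk0 : 0 < k := Real.sqrt_pos.mpr hd
  have hk2 : E - Em = k ^ 2 := (Real.sq_sqrt hd.le).symm
  have hI : ∀ t, HasDerivAt (fun t ↦ ∫ s in y..t, |V s - Em|) |V t - Em| t := fun t ↦
    have hc : Continuous fun s ↦ |V s - Em| := by fun_prop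
    intervalIntegral.integral_hasDerivAt_right (hc.intervalIntegrable _ _)
      (hc.stronglyMeasurableAtFilter _ _) hc.continuousAt
  have hF : ∀ t ∈ Set.Icc y x, HasDerivAt
      (fun t ↦ (ψ t ^ 2 + ψ' t ^ 2 / (E - Em)) *
        Real.exp (-((1 / k) * ∫ s in y..t, |V s - Em|)))
      ((2 * ψ t * ψ' t * (V t - Em) / k ^ 2 -
        |V t - Em| / k * (ψ t ^ 2 + ψ' t ^ 2 / k ^ 2)) *
        Real.exp (-((1 / k) * ∫ s in y..t, |V s - Em|))) t := by
    intro t ht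
    have h := (((hψ t ht).pow 2).add (((hψ' t ht).pow 2).div_const (E - Em))).mul
      ((hI t).const_mul (1 / k)).neg.exp
    refine h.congr_deriv ?_
    have h2 : ψ'' t = (V t - Em - k ^ 2) * ψ t := by
      rw [← hk2]
      linarith [heq t ht]
    simp only [Pi.add_apply, Pi.pow_apply, Pi.neg_apply, h2, hk2]
    field_simp
    push_cast
    ring
  have hanti := antitoneOn_of_hasDerivWithinAt_nonpos (convex_Icc y x)
    (fun t ht ↦ (hF t ht).continuousAt.continuousWithinAt)
    (fun t ht ↦ (hF t (interior_subset ht)).hasDerivWithinAt) (by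
      intro t _
      refine mul_nonpos_of_nonpos_of_nonneg (sub_nonpos.mpr ?_) (Real.exp_pos _).le
      set a := ψ' t / k with ha
      have hψa : ψ' t = a * k := by rw [ha]; field_simp
      have habs : 2 * ψ t * a * (V t - Em) ≤ |V t - Em| * (ψ t ^ 2 + a ^ 2) := by
        have h1 : |2 * ψ t * a| ≤ ψ t ^ 2 + a ^ 2 := abs_le.mpr
          ⟨by nlinarith [sq_nonneg (ψ t + a)], by nlinarith [sq_nonneg (ψ t - a)]⟩
        calc 2 * ψ t * a * (V t - Em) ≤ |2 * ψ t * a * (V t - Em)| := le_abs_self _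
          _ = |V t - Em| * |2 * ψ t * a| := by rw [abs_mul, mul_comm]
          _ ≤ _ := by gcongr
      calc 2 * ψ t * ψ' t * (V t - Em) / k ^ 2 = 2 * ψ t * a * (V t - Em) / k := by
            rw [hψa]; field_simp
        _ ≤ |V t - Em| * (ψ t ^ 2 + a ^ 2) / k := by gcongr
        _ = _ := by rw [hψa]; field_simp)
  have h := hanti (Set.left_mem_Icc.mpr hyx) (Set.right_mem_Icc.mpr hyx) hyx
  simp only [intervalIntegral.integral_same, mul_zero, neg_zero, Real.exp_zero, mul_one] at h
  rwa [Real.exp_neg, ← div_eq_mul_inv, div_le_iff₀ (Real.exp_pos _)] at h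
end

section
/- Let V : ℝ → ℝ be continuous, let E ∈ ℝ and k > 0, and let x₁ < x₂ with x₂ − x₁ ≥ π/k. Let ψ : ℝ → ℝ be a real-valued, not identically zero solution of the Schrödinger equation with potential V and energy E on [x₁, x₂], and suppose E − V(x) ≥ k² for all x ∈ [x₁, x₂]. Then there exists c ∈ [x₁, x₂] such that ψ'(c) = 0. -/
/-- **Sturm oscillation.** If `k > 0`, `x₂ - x₁ ≥ π/k`, `ψ` is a not-identically-zero
solution of the Schrödinger equation `-ψ'' + Vψ = Eψ` on `[x₁,x₂]` (twice continuously
differentiable there), and `E - V ≥ k²` on `[x₁,x₂]`, then `ψ'` vanishes somewhere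
in `[x₁,x₂]`. -/
theorem stmt_2
    (V ψ ψ' ψ'' : ℝ → ℝ) (E k x₁ x₂ : ℝ)
    (hV : Continuous V) (hk : 0 < k) (h12 : x₁ < x₂) (hlen : x₂ - x₁ ≥ Real.pi / k)
    (hψ : ∀ t ∈ Set.Icc x₁ x₂, HasDerivAt ψ (ψ' t) t)
    (hψ' : ∀ t ∈ Set.Icc x₁ x₂, HasDerivAt ψ' (ψ'' t) t)
    (hψ'' : ContinuousOn ψ'' (Set.Icc x₁ x₂))
    (heq : ∀ t ∈ Set.Icc x₁ x₂, -ψ'' t + V t * ψ t = E * ψ t)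
    (hne : ∃ t ∈ Set.Icc x₁ x₂, ψ t ≠ 0)
    (hcl : ∀ t ∈ Set.Icc x₁ x₂, E - V t ≥ k ^ 2) :
    ∃ c ∈ Set.Icc x₁ x₂, ψ' c = 0 := by
  by_contra! hc
  have hg : ∀ t ∈ Set.Icc x₁ x₂, HasDerivAt (fun x => Real.arctan (k * (ψ x / ψ' x)))
      (1 / (1 + (k * (ψ t / ψ' t)) ^ 2) *
        (k * ((ψ' t * ψ' t - ψ t * ψ'' t) / ψ' t ^ 2))) t := fun t ht =>
    (((hψ t ht).div (hψ' t ht) (hc t ht)).const_mul k).arctan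
  obtain ⟨c, hcm, hslope⟩ := exists_hasDerivAt_eq_slope _ _ h12
    (fun t ht => (hg t ht).continuousAt.continuousWithinAt)
    (fun t ht => hg t (Set.Ioo_subset_Icc_self ht))
  have hcI := Set.Ioo_subset_Icc_self hcm
  have hderiv : k ≤ 1 / (1 + (k * (ψ c / ψ' c)) ^ 2) *
      (k * ((ψ' c * ψ' c - ψ c * ψ'' c) / ψ' c ^ 2)) := by
    have hne' := hc c hcI
    have hriccati : (ψ' c * ψ' c - ψ c * ψ'' c) / ψ' c ^ 2 =
        1 + (E - V c) * (ψ c / ψ' c) ^ 2 := by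
      have : ψ'' c = (V c - E) * ψ c := by linarith [heq c hcI]
      rw [this]
      field_simp
      ring
    rw [hriccati, one_div_mul_eq_div, le_div_iff₀ (by positivity)]
    refine mul_le_mul_of_nonneg_left ?_ hk.le
    rw [mul_pow]
    gcongr
    exact hcl c hcI
  rw [hslope, le_div_iff₀ (sub_pos.mpr h12)] at hderiv
  have hpi : Real.pi ≤ k * (x₂ - x₁) := by
    rw [mul_comm]
    exact (div_le_iff₀ hk).mp hlen
  linarith [Real.arctan_lt_pi_div_two (k * (ψ x₂ / ψ' x₂)),
    Real.neg_pi_div_two_lt_arctan (k * (ψ x₁ / ψ' x₁))]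
end

section
/- Let V : ℝ → ℝ be continuous, let E, E_m ∈ ℝ with E_m < E, let k > 0, and let x₁ < x₂ with x₂ − x₁ ≥ π/k. Suppose E − V(t) ≥ k² for all t ∈ [x₁, x₂]. Let x ≥ x₂ and let ψ : ℝ → ℝ satisfy the Schrödinger equation with potential V and energy E on [x₁, x]. Then |ψ(x)| ≤ √( ψ(x)² + ψ'(x)²/(E−E_m) ) ≤ ( sup_{t ∈ [x₁,x₂]} |ψ(t)| ) · exp( (1/(2√(E−E_m))) ∫_{x₁}^x |V(t) − E_m| dt ). -/
/-- **Sturm oscillation for the derivative.** A solution of `ψ'' = -q ψ` with `q ≥ k²` on an interval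
of length at least `π / k` has a critical point in that interval. -/
theorem exists_deriv_eq_zero_of_pi_div_le {ψ ψ' q : ℝ → ℝ} {k a b : ℝ} (hk : 0 < k) (hab : a ≤ b)
    (hlen : Real.pi / k ≤ b - a) (hq : ∀ t ∈ Set.Icc a b, k ^ 2 ≤ q t)
    (hψ : ∀ t ∈ Set.Icc a b, HasDerivAt ψ (ψ' t) t)
    (hψ' : ∀ t ∈ Set.Icc a b, HasDerivAt ψ' (-q t * ψ t) t) :
    ∃ t ∈ Set.Icc a b, ψ' t = 0 := by
  by_contra! hne
  have hd : ∀ t ∈ Set.Icc a b, HasDerivAt (fun s => Real.arctan (k * (ψ s / ψ' s)) - k * s)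
      (1 / (1 + (k * (ψ t / ψ' t)) ^ 2) *
        (k * ((ψ' t * ψ' t - ψ t * (-q t * ψ t)) / ψ' t ^ 2)) - k * 1) t := fun t ht =>
    (((hψ t ht).div (hψ' t ht) (hne t ht)).const_mul k).arctan.sub ((hasDerivAt_id t).const_mul k)
  have hmono : MonotoneOn (fun s => Real.arctan (k * (ψ s / ψ' s)) - k * s) (Set.Icc a b) := by
    refine monotoneOn_of_hasDerivWithinAt_nonneg (convex_Icc a b)
      (fun t ht => (hd t ht).continuousAt.continuousWithinAt)
      (fun t ht => (hd t (interior_subset ht)).hasDerivWithinAt) fun t ht => ?_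
    have ht := interior_subset ht
    have h0 := hne t ht
    have hquot : (ψ' t * ψ' t - ψ t * (-q t * ψ t)) / ψ' t ^ 2 = 1 + q t * (ψ t / ψ' t) ^ 2 := by
      field_simp
      ring
    have hle : 1 + (k * (ψ t / ψ' t)) ^ 2 ≤ 1 + q t * (ψ t / ψ' t) ^ 2 := by
      rw [mul_pow]
      gcongr
      exact hq t ht
    rw [hquot, mul_one, sub_nonneg, one_div_mul_eq_div, le_div_iff₀ (by positivity)]
    exact mul_le_mul_of_nonneg_left hle hk.le
  have h := hmono (Set.left_mem_Icc.2 hab) (Set.right_mem_Icc.2 hab) hab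
  simp only at h
  have h1 := Real.arctan_lt_pi_div_two (k * (ψ b / ψ' b))
  have h2 := Real.neg_pi_div_two_lt_arctan (k * (ψ a / ψ' a))
  rw [div_le_iff₀ hk] at hlen
  linarith

/-- Grönwall's inequality for `g' ≤ f g` with a continuous rate `f`. -/
theorem le_mul_exp_integral_of_hasDerivAt_le {f g g' : ℝ → ℝ} {a b : ℝ} (hab : a ≤ b)
    (hf : Continuous f) (hg : ∀ t ∈ Set.Icc a b, HasDerivAt g (g' t) t)
    (hle : ∀ t ∈ Set.Icc a b, g' t ≤ f t * g t) :
    g b ≤ g a * Real.exp (∫ t in a..b, f t) := by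
  have hd : ∀ t ∈ Set.Icc a b, HasDerivAt (fun s => g s * Real.exp (-∫ r in a..s, f r))
      (g' t * Real.exp (-∫ r in a..t, f r) +
        g t * (Real.exp (-∫ r in a..t, f r) * -f t)) t := fun t ht =>
    (hg t ht).mul (hf.integral_hasStrictDerivAt a t).hasDerivAt.neg.exp
  have hanti : AntitoneOn (fun s => g s * Real.exp (-∫ r in a..s, f r)) (Set.Icc a b) := by
    refine antitoneOn_of_hasDerivWithinAt_nonpos (convex_Icc a b)
      (fun t ht => (hd t ht).continuousAt.continuousWithinAt)
      (fun t ht => (hd t (interior_subset ht)).hasDerivWithinAt) fun t ht => ?_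
    have := mul_le_mul_of_nonneg_right (hle t (interior_subset ht))
      (Real.exp_pos (-∫ r in a..t, f r)).le
    linarith
  have h := hanti (Set.left_mem_Icc.2 hab) (Set.right_mem_Icc.2 hab) hab
  simp only [intervalIntegral.integral_same, neg_zero, Real.exp_zero, mul_one] at h
  rwa [Real.exp_neg, ← div_eq_mul_inv, div_le_iff₀ (Real.exp_pos _)] at h

/-- **Davies' growth bound** for the energy `ψ² + ψ'² / ω²` of a solution of
`ψ'' = (W - ω²) ψ`. -/
theorem sq_add_sq_div_le_mul_exp_integral {W ψ ψ' : ℝ → ℝ} {ω a b : ℝ} (hω : 0 < ω) (hab : a ≤ b)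
    (hW : Continuous W) (hψ : ∀ t ∈ Set.Icc a b, HasDerivAt ψ (ψ' t) t)
    (hψ' : ∀ t ∈ Set.Icc a b, HasDerivAt ψ' ((W t - ω ^ 2) * ψ t) t) :
    ψ b ^ 2 + ψ' b ^ 2 / ω ^ 2 ≤
      (ψ a ^ 2 + ψ' a ^ 2 / ω ^ 2) * Real.exp (1 / ω * ∫ t in a..b, |W t|) := by
  rw [← intervalIntegral.integral_const_mul]
  refine le_mul_exp_integral_of_hasDerivAt_le (g := fun t => ψ t ^ 2 + ψ' t ^ 2 / ω ^ 2) hab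
    (hW.abs.const_mul _)
    (fun t ht => ((hψ t ht).pow 2).add (((hψ' t ht).pow 2).div_const (ω ^ 2))) fun t ht => ?_
  have hamgm : 2 * |ψ t * (ψ' t / ω)| ≤ ψ t ^ 2 + ψ' t ^ 2 / ω ^ 2 := by
    have := two_mul_le_add_sq |ψ t| |ψ' t / ω|
    rwa [sq_abs, sq_abs, div_pow, mul_assoc, ← abs_mul] at this
  calc _ = 1 / ω * (W t * (2 * (ψ t * (ψ' t / ω)))) := by
        push_cast
        field_simp
        ring
    _ ≤ 1 / ω * (|W t| * (2 * |ψ t * (ψ' t / ω)|)) := by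
        refine mul_le_mul_of_nonneg_left ((le_abs_self _).trans_eq ?_) (by positivity)
        rw [abs_mul, abs_mul 2, abs_two]
    _ ≤ 1 / ω * (|W t| * (ψ t ^ 2 + ψ' t ^ 2 / ω ^ 2)) := by gcongr
    _ = _ := by ring


/-- **Derivative-free landscape bound from Davies' inequality and Sturm oscillation.**
If `E_m < E`, `k > 0`, `x₂ - x₁ ≥ π/k`, `E - V ≥ k²` on `[x₁,x₂]`, `x ≥ x₂`, and `ψ`
satisfies the Schrödinger equation on `[x₁,x]`, then
`|ψ(x)| ≤ √(ψ(x)² + ψ'(x)²/(E-E_m))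
        ≤ (sup_{[x₁,x₂]} |ψ|) · exp((1/(2√(E-E_m))) ∫_{x₁}^x |V - E_m|)`. -/
theorem stmt_3
    (V ψ ψ' ψ'' : ℝ → ℝ) (E Em k x₁ x₂ x : ℝ)
    (hV : Continuous V) (hE : Em < E) (hk : 0 < k)
    (h12 : x₁ < x₂) (hlen : x₂ - x₁ ≥ Real.pi / k)
    (hcl : ∀ t ∈ Set.Icc x₁ x₂, E - V t ≥ k ^ 2)
    (hx : x₂ ≤ x)
    (hψ : ∀ t ∈ Set.Icc x₁ x, HasDerivAt ψ (ψ' t) t)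
    (hψ' : ∀ t ∈ Set.Icc x₁ x, HasDerivAt ψ' (ψ'' t) t)
    (hψ'' : ContinuousOn ψ'' (Set.Icc x₁ x))
    (heq : ∀ t ∈ Set.Icc x₁ x, -ψ'' t + V t * ψ t = E * ψ t) :
    |ψ x| ≤ Real.sqrt (ψ x ^ 2 + ψ' x ^ 2 / (E - Em)) ∧
      Real.sqrt (ψ x ^ 2 + ψ' x ^ 2 / (E - Em)) ≤
        sSup ((fun t => |ψ t|) '' Set.Icc x₁ x₂) *
          Real.exp ((1 / (2 * Real.sqrt (E - Em))) * ∫ t in x₁..x, |V t - Em|) := by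
  have hpos : 0 < E - Em := sub_pos.2 hE
  refine ⟨Real.abs_le_sqrt (le_add_of_nonneg_right (by positivity)), ?_⟩
  have hsub : Set.Icc x₁ x₂ ⊆ Set.Icc x₁ x := Set.Icc_subset_Icc_right hx
  obtain ⟨t, ht, ht0⟩ := exists_deriv_eq_zero_of_pi_div_le (q := fun t => E - V t) hk h12.le hlen hcl
    (fun t ht => hψ t (hsub ht)) fun t ht =>
      (hψ' t (hsub ht)).congr_deriv (by linarith [heq t (hsub ht)])
  have hω : 0 < √(E - Em) := Real.sqrt_pos.2 hpos
  have hω2 : √(E - Em) ^ 2 = E - Em := Real.sq_sqrt hpos.le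
  have htx : t ≤ x := ht.2.trans hx
  have htsub : Set.Icc t x ⊆ Set.Icc x₁ x := Set.Icc_subset_Icc_left ht.1
  have hW : Continuous fun s => V s - Em := hV.sub continuous_const
  have hgrow := sq_add_sq_div_le_mul_exp_integral hω htx hW
    (fun s hs => hψ s (htsub hs)) fun s hs =>
      (hψ' s (htsub hs)).congr_deriv (by rw [hω2]; linarith [heq s (htsub hs)])
  have hint : ∫ s in t..x, |V s - Em| ≤ ∫ s in x₁..x, |V s - Em| :=
    intervalIntegral.integral_mono_interval ht.1 htx le_rfl
      (Filter.Eventually.of_forall fun _ => abs_nonneg _) (hW.abs.intervalIntegrable _ _)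
  have hsup : |ψ t| ≤ sSup ((fun t => |ψ t|) '' Set.Icc x₁ x₂) := by
    refine le_csSup (isCompact_Icc.bddAbove_image fun s hs => ?_) (Set.mem_image_of_mem _ ht)
    exact (hψ s (hsub hs)).continuousAt.abs.continuousWithinAt
  rw [hω2, ht0, zero_pow two_ne_zero, zero_div, add_zero] at hgrow
  calc √(ψ x ^ 2 + ψ' x ^ 2 / (E - Em))
      ≤ |ψ t| * Real.exp (1 / (2 * √(E - Em)) * ∫ s in t..x, |V s - Em|) := by
        refine Real.sqrt_le_iff.2 ⟨by positivity, hgrow.trans_eq ?_⟩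
        rw [mul_pow, sq_abs, ← Real.exp_nat_mul]
        congr 2
        push_cast
        field_simp
    _ ≤ _ := by
        have := (abs_nonneg _).trans hsup
        gcongr
end

section
/- Let V : ℝ → ℝ be continuous, let E ∈ ℝ, let α < β, and let 0 < ℓ ≤ (β−α)/2. Let ψ : ℝ → ℝ satisfy the Schrödinger equation with potential V and energy E on [α, β]. Then for every x ∈ [α+ℓ, β−ℓ], ψ(x)² ≤ ( (1/ℓ²) ( ∫_α^{α+ℓ} ψ(t)² dt + ∫_{β−ℓ}^β ψ(t)² dt ) + ∫_α^β max(E − V(t), 0) · ψ(t)² dt ) · min(x−α, β−x). -/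
open MeasureTheory Set

/-- Energy inequality for a solution of `ψ'' = (V - E) ψ` cut off by the affine function
`t ↦ k + m * t`; the parameter `c` linearizes the Cauchy-Schwarz inequality. -/
theorem affine_cutoff_energy_le {V ψ ψ' ψ'' : ℝ → ℝ} {E p q : ℝ} (k m c : ℝ)
    (hV : Continuous V) (hpq : p ≤ q)
    (hψ : ∀ x ∈ Icc p q, HasDerivAt ψ (ψ' x) x)
    (hψ' : ∀ x ∈ Icc p q, HasDerivAt ψ' (ψ'' x) x)
    (heq : ∀ x ∈ Icc p q, -ψ'' x + V x * ψ x = E * ψ x)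
    (hχ : ∀ x ∈ Icc p q, (k + m * x) ^ 2 ≤ 1) :
    2 * c * ((k + m * q) * ψ q - (k + m * p) * ψ p) - c ^ 2 * (q - p) ≤
      m ^ 2 * (∫ t in p..q, ψ t ^ 2) +
        ((k + m * q) ^ 2 * (ψ q * ψ' q) - (k + m * p) ^ 2 * (ψ p * ψ' p)) +
        ∫ t in p..q, max (E - V t) 0 * ψ t ^ 2 := by
  have hψc : ContinuousOn ψ (Icc p q) := fun x hx => (hψ x hx).continuousAt.continuousWithinAt
  have hsq : ContinuousOn (fun t => ψ t ^ 2) (Icc p q) := hψc.pow 2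
  have hpot : ContinuousOn (fun t => max (E - V t) 0 * ψ t ^ 2) (Icc p q) :=
    ((continuous_const.sub hV).max continuous_const).continuousOn.mul hsq
  have hderiv : ∀ x ∈ Icc p q, HasDerivAt
      (fun t => (k + m * t) ^ 2 * (ψ t * ψ' t) - 2 * c * ((k + m * t) * ψ t) + c ^ 2 * t)
      ((m * ψ x + (k + m * x) * ψ' x - c) ^ 2 - m ^ 2 * ψ x ^ 2
        - (E - V x) * (k + m * x) ^ 2 * ψ x ^ 2) x := by
    intro x hx
    have hlin : HasDerivAt (fun t => k + m * t) m x := by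
      simpa using ((hasDerivAt_id x).const_mul m).const_add k
    have h := (((hlin.pow 2).mul ((hψ x hx).mul (hψ' x hx))).sub
      ((hlin.mul (hψ x hx)).const_mul (2 * c))).add ((hasDerivAt_id x).const_mul (c ^ 2))
    have hψ''x : ψ'' x = (V x - E) * ψ x := by linarith [heq x hx]
    refine h.congr_deriv ?_
    simp only [Pi.mul_apply, Pi.pow_apply, hψ''x]
    push_cast
    ring
  have hint : IntervalIntegrable (fun t => m ^ 2 * ψ t ^ 2) volume p q :=
    (hsq.const_smul (m ^ 2)).intervalIntegrable_of_Icc hpq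
  have hint' : IntervalIntegrable (fun t => max (E - V t) 0 * ψ t ^ 2) volume p q :=
    hpot.intervalIntegrable_of_Icc hpq
  have key := intervalIntegral.integral_le_sub_of_hasDeriv_right_of_le hpq
    (fun x hx => (hderiv x hx).continuousAt.continuousWithinAt)
    (fun x hx => (hderiv x (Ioo_subset_Icc_self hx)).hasDerivWithinAt)
    (φ := fun t => -(m ^ 2 * ψ t ^ 2 + max (E - V t) 0 * ψ t ^ 2))
    (((hsq.const_smul (m ^ 2)).add hpot).neg.integrableOn_Icc)
    (fun x hx => by
      have h1 : (E - V x) * (k + m * x) ^ 2 ≤ max (E - V x) 0 := calc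
        _ ≤ max (E - V x) 0 * (k + m * x) ^ 2 := by gcongr; exact le_max_left _ _
        _ ≤ max (E - V x) 0 :=
          mul_le_of_le_one_right (le_max_right _ _) (hχ x (Ioo_subset_Icc_self hx))
      have h2 := mul_le_mul_of_nonneg_right h1 (sq_nonneg (ψ x))
      have h3 := sq_nonneg (m * ψ x + (k + m * x) * ψ' x - c)
      linarith)
  rw [intervalIntegral.integral_neg, intervalIntegral.integral_add hint hint',
    intervalIntegral.integral_const_mul] at key
  linarith


/-- **Window estimate in the transition régime.** Let `ψ` satisfy the Schrödinger
equation on the window `W = [α,β]`, and let `0 < ℓ ≤ (β-α)/2`.  Then for every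
`x ∈ [α+ℓ, β-ℓ]`,
`ψ(x)² ≤ ((1/ℓ²)(∫_α^{α+ℓ} ψ² + ∫_{β-ℓ}^β ψ²) + ∫_α^β (E-V)₊ ψ²) · min(x-α, β-x)`. -/
theorem stmt_4
    (V ψ ψ' ψ'' : ℝ → ℝ) (E α β ℓ : ℝ)
    (hV : Continuous V) (hαβ : α < β) (hℓ : 0 < ℓ) (hℓ2 : ℓ ≤ (β - α) / 2)
    (hψ : ∀ x ∈ Set.Icc α β, HasDerivAt ψ (ψ' x) x)
    (hψ' : ∀ x ∈ Set.Icc α β, HasDerivAt ψ' (ψ'' x) x)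
    (hψ'' : ContinuousOn ψ'' (Set.Icc α β))
    (heq : ∀ x ∈ Set.Icc α β, -ψ'' x + V x * ψ x = E * ψ x) :
    ∀ x ∈ Set.Icc (α + ℓ) (β - ℓ),
      ψ x ^ 2 ≤
        ((1 / ℓ ^ 2) * ((∫ t in α..(α + ℓ), ψ t ^ 2) + ∫ t in (β - ℓ)..β, ψ t ^ 2) +
            ∫ t in α..β, max (E - V t) 0 * ψ t ^ 2) *
          min (x - α) (β - x) := by
  intro x ⟨hx₁, hx₂⟩
  have hsq : ContinuousOn (fun t => ψ t ^ 2) (Icc α β) :=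
    fun t ht => ((hψ t ht).continuousAt.pow 2).continuousWithinAt
  have hpot : ContinuousOn (fun t => max (E - V t) 0 * ψ t ^ 2) (Icc α β) :=
    ((continuous_const.sub hV).max continuous_const).continuousOn.mul hsq
  have hpot_int : ∀ {a b}, α ≤ a → a ≤ b → b ≤ β →
      IntervalIntegrable (fun t => max (E - V t) 0 * ψ t ^ 2) volume a b :=
    fun ha hab hb => (hpot.mono (Icc_subset_Icc ha hb)).intervalIntegrable_of_Icc hab
  set K := (1 / ℓ ^ 2) * ((∫ t in α..(α + ℓ), ψ t ^ 2) + ∫ t in (β - ℓ)..β, ψ t ^ 2) +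
    ∫ t in α..β, max (E - V t) 0 * ψ t ^ 2 with hK
  have energy : ∀ {a b}, α ≤ a → a ≤ b → b ≤ β → ∀ k m c : ℝ,
      (∀ t ∈ Icc a b, (k + m * t) ^ 2 ≤ 1) → _ := fun ha hab hb k m c hχ =>
    have hs := Icc_subset_Icc ha hb
    affine_cutoff_energy_le k m c hV hab (fun t ht => hψ t (hs ht)) (fun t ht => hψ' t (hs ht))
      (fun t ht => heq t (hs ht)) hχ
  have total : ∀ c d : ℝ,
      2 * c * ψ x - c ^ 2 * (x - α) + (2 * d * ψ x - d ^ 2 * (β - x)) ≤ K := by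
    intro c d
    have e₁ := energy le_rfl (by linarith : α ≤ α + ℓ) (by linarith) (-α / ℓ) (1 / ℓ) c
      (fun t ht => by
        have : -α / ℓ + 1 / ℓ * t = (t - α) / ℓ := by ring
        rw [this]
        exact pow_le_one₀ (div_nonneg (by linarith [ht.1]) hℓ.le)
          ((div_le_one hℓ).2 (by linarith [ht.2])))
    have e₂ := energy (by linarith) hx₁ (by linarith) 1 0 c (by simp)
    have e₃ := energy (by linarith) hx₂ (by linarith) 1 0 (-d) (by simp)
    have e₄ := energy (by linarith) (by linarith : β - ℓ ≤ β) le_rfl (β / ℓ) (-(1 / ℓ)) (-d)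
      (fun t ht => by
        have : β / ℓ + -(1 / ℓ) * t = (β - t) / ℓ := by ring
        rw [this]
        exact pow_le_one₀ (div_nonneg (by linarith [ht.2]) hℓ.le)
          ((div_le_one hℓ).2 (by linarith [ht.1])))
    have v₁ : -α / ℓ + 1 / ℓ * α = 0 := by ring
    have v₂ : -α / ℓ + 1 / ℓ * (α + ℓ) = 1 := by field_simp; ring
    have v₃ : β / ℓ + -(1 / ℓ) * (β - ℓ) = 1 := by field_simp; ring
    have v₄ : β / ℓ + -(1 / ℓ) * β = 0 := by ring
    rw [v₁, v₂, div_pow, one_pow] at e₁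
    rw [v₃, v₄, neg_sq, neg_sq, div_pow, one_pow] at e₄
    have i₁ := hpot_int le_rfl (by linarith : α ≤ α + ℓ) (by linarith)
    have i₂ := hpot_int (by linarith) hx₁ (by linarith)
    have i₃ := hpot_int (by linarith) hx₂ (by linarith)
    have i₄ := hpot_int (by linarith) (by linarith : β - ℓ ≤ β) le_rfl
    rw [← intervalIntegral.integral_add_adjacent_intervals ((i₁.trans i₂).trans i₃) i₄,
      ← intervalIntegral.integral_add_adjacent_intervals (i₁.trans i₂) i₃,
      ← intervalIntegral.integral_add_adjacent_intervals i₁ i₂] at hK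
    linarith
  have bound : ∀ y : ℝ, 0 < y → 2 * (ψ x / y) * ψ x - (ψ x / y) ^ 2 * y ≤ K →
      ψ x ^ 2 ≤ K * y := by
    intro y hy h
    have : 2 * (ψ x / y) * ψ x - (ψ x / y) ^ 2 * y = ψ x ^ 2 / y := by field_simp; ring
    rwa [this, div_le_iff₀ hy] at h
  rcases min_choice (x - α) (β - x) with h | h <;> rw [h]
  · exact bound _ (by linarith) (by simpa using total (ψ x / (x - α)) 0)
  · exact bound _ (by linarith) (by simpa using total 0 (ψ x / (β - x)))
end

section
/- Let V : ℝ → ℝ be continuous, let E ∈ ℝ, let x₀ ≤ x, and let ψ : ℝ → ℝ satisfy the Schrödinger equation with potential V and energy E on [x₀, x]. Then |ψ(x)| ≤ ( |ψ(x₀)| + (x − x₀) |ψ'(x₀)| ) · exp( ∫_{x₀}^x (x − t) |V(t) − E| dt ). -/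
open Set intervalIntegral MeasureTheory in
/-- **Gronwall's inequality**, integral form: if `k ≥ 0` and `u s ≤ A + ∫_a^s k u` for all `s` in
`[a, b]`, then `u b ≤ A · exp (∫_a^b k)`. -/
theorem le_mul_exp_integral_of_le_add_integral {k u : ℝ → ℝ} {A a b : ℝ} (hab : a ≤ b)
    (hk : ContinuousOn k (Icc a b)) (hu : ContinuousOn u (Icc a b))
    (hk0 : ∀ t ∈ Icc a b, 0 ≤ k t)
    (h : ∀ s ∈ Icc a b, u s ≤ A + ∫ t in a..s, k t * u t) :
    u b ≤ A * Real.exp (∫ t in a..b, k t) := by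
  have hprim : ∀ f : ℝ → ℝ, ContinuousOn f (Icc a b) →
      ContinuousOn (fun s => ∫ t in a..s, f t) (Icc a b) ∧
      ∀ s ∈ Ioo a b, HasDerivAt (fun s => ∫ t in a..s, f t) (f s) s := by
    intro f hf
    refine ⟨?_, fun s hs => ?_⟩
    · have := continuousOn_primitive_interval (μ := volume) (f := f) (a := a) (b := b)
        (by rw [uIcc_of_le hab]; exact hf.integrableOn_Icc)
      rwa [uIcc_of_le hab] at this
    · refine integral_hasDerivAt_right ?_ ?_ (hf.continuousAt (Icc_mem_nhds hs.1 hs.2))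
      · exact (hf.mono (Icc_subset_Icc_right hs.2.le)).intervalIntegrable_of_Icc hs.1.le
      · exact (hf.mono Ioo_subset_Icc_self).stronglyMeasurableAtFilter isOpen_Ioo s hs
  obtain ⟨hKc, hKd⟩ := hprim k hk
  obtain ⟨hRc, hRd⟩ := hprim _ (hk.mul hu)
  have hanti : AntitoneOn
      (fun s => (A + ∫ t in a..s, k t * u t) * Real.exp (-∫ t in a..s, k t)) (Icc a b) := by
    have hd : ∀ s ∈ Ioo a b, HasDerivAt
        (fun s => (A + ∫ t in a..s, k t * u t) * Real.exp (-∫ t in a..s, k t)) _ s :=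
      fun s hs => ((hRd s hs).const_add A).mul (hKd s hs).neg.exp
    refine antitoneOn_of_deriv_nonpos (convex_Icc a b)
      ((continuousOn_const.add hRc).mul hKc.neg.rexp) ?_ ?_
    · rw [interior_Icc]
      exact fun s hs => (hd s hs).differentiableAt.differentiableWithinAt
    · rw [interior_Icc]
      intro s hs
      rw [(hd s hs).deriv]
      have hs' := Ioo_subset_Icc_self hs
      have := mul_nonneg (mul_nonneg (hk0 s hs') (sub_nonneg.2 (h s hs')))
        (Real.exp_pos (-∫ t in a..s, k t)).le
      simp only [Pi.mul_apply, Pi.neg_apply] at this ⊢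
      linarith
  have hle := hanti (left_mem_Icc.2 hab) (right_mem_Icc.2 hab) hab
  simp only [integral_same, add_zero, neg_zero, Real.exp_zero, mul_one, Real.exp_neg] at hle
  exact (h b (right_mem_Icc.2 hab)).trans
    ((mul_inv_le_iff₀ (Real.exp_pos _)).1 hle)

open Set intervalIntegral in
/-- Taylor's formula of order two with integral remainder. -/
theorem eq_add_integral_of_hasDerivAt_two {f f' f'' : ℝ → ℝ} {a s : ℝ} (has : a ≤ s)
    (hf : ∀ t ∈ Icc a s, HasDerivAt f (f' t) t) (hf' : ∀ t ∈ Icc a s, HasDerivAt f' (f'' t) t)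
    (hf'' : ContinuousOn f'' (Icc a s)) :
    f s = f a + (s - a) * f' a + ∫ t in a..s, (s - t) * f'' t := by
  have hd : ∀ t ∈ uIcc a s,
      HasDerivAt (fun t => f t + (s - t) * f' t) ((s - t) * f'' t) t := by
    rw [uIcc_of_le has]
    intro t ht
    refine ((hf t ht).add (((hasDerivAt_id t).const_sub s).mul (hf' t ht))).congr_deriv ?_
    simp only [id]
    ring
  have hc : ContinuousOn (fun t => (s - t) * f'' t) (Icc a s) := by fun_prop
  rw [integral_eq_sub_of_hasDerivAt hd (hc.intervalIntegrable_of_Icc has)]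
  ring

/-- **Gronwall shooting bound.** If `x₀ ≤ x` and `ψ` satisfies the Schrödinger
equation `-ψ'' + Vψ = Eψ` on `[x₀,x]` (twice continuously differentiable there), then
`|ψ(x)| ≤ (|ψ(x₀)| + (x-x₀)|ψ'(x₀)|) · exp(∫_{x₀}^x (x-t)|V(t)-E| dt)`. -/
theorem stmt_5
    (V ψ ψ' ψ'' : ℝ → ℝ) (E x₀ x : ℝ)
    (hV : Continuous V) (hx : x₀ ≤ x)
    (hψ : ∀ t ∈ Set.Icc x₀ x, HasDerivAt ψ (ψ' t) t)
    (hψ' : ∀ t ∈ Set.Icc x₀ x, HasDerivAt ψ' (ψ'' t) t)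
    (hψ'' : ContinuousOn ψ'' (Set.Icc x₀ x))
    (heq : ∀ t ∈ Set.Icc x₀ x, -ψ'' t + V t * ψ t = E * ψ t) :
    |ψ x| ≤ (|ψ x₀| + (x - x₀) * |ψ' x₀|) *
      Real.exp (∫ t in x₀..x, (x - t) * |V t - E|) := by
  have hψc : ContinuousOn ψ (Set.Icc x₀ x) := fun t ht => (hψ t ht).continuousAt.continuousWithinAt
  refine le_mul_exp_integral_of_le_add_integral (k := fun t => (x - t) * |V t - E|)
    (u := fun t => |ψ t|) hx (by fun_prop) hψc.abs
    (fun t ht => mul_nonneg (sub_nonneg.2 ht.2) (abs_nonneg _)) fun s hs => ?_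
  have hsub : Set.Icc x₀ s ⊆ Set.Icc x₀ x := Set.Icc_subset_Icc_right hs.2
  have hψs := hψc.mono hsub
  have hψs'' := hψ''.mono hsub
  have hint : |∫ t in x₀..s, (s - t) * ψ'' t| ≤ ∫ t in x₀..s, (x - t) * |V t - E| * |ψ t| := by
    refine (intervalIntegral.abs_integral_le_integral_abs hs.1).trans
      (intervalIntegral.integral_mono_on hs.1 ?_ ?_ fun t ht => ?_)
    · exact ContinuousOn.intervalIntegrable_of_Icc hs.1 (by fun_prop)
    · exact ContinuousOn.intervalIntegrable_of_Icc hs.1 (by fun_prop)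
    · have hψt : ψ'' t = (V t - E) * ψ t := by linarith [heq t (hsub ht)]
      rw [hψt, abs_mul, abs_mul, abs_of_nonneg (sub_nonneg.2 ht.2), ← mul_assoc]
      gcongr
      exact hs.2
  have hinit : |(s - x₀) * ψ' x₀| ≤ (x - x₀) * |ψ' x₀| := by
    rw [abs_mul, abs_of_nonneg (sub_nonneg.2 hs.1)]
    gcongr
    exact hs.2
  have htaylor := eq_add_integral_of_hasDerivAt_two hs.1 (fun t ht => hψ t (hsub ht))
    (fun t ht => hψ' t (hsub ht)) hψs''
  calc |ψ s| ≤ |ψ x₀| + |(s - x₀) * ψ' x₀| + |∫ t in x₀..s, (s - t) * ψ'' t| := by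
        rw [htaylor]
        exact abs_add_three _ _ _
    _ ≤ _ := by gcongr
end

section
/- Let a < b, let Φ : [a,b] → ℝ be twice continuously differentiable with Φ(x) > 0 for all x ∈ [a,b], and let f : [a,b] → ℝ be continuously differentiable with f(a) = f(b) = 0. Then ∫_a^b f'(x)² dx ≥ ∫_a^b f(x)² · ( −Φ''(x)/Φ(x) ) dx. -/
/-- **Picone's identity** in one variable: `(f')² + f² Φ''/Φ` and the derivative of `f² Φ'/Φ` differ
by the square of `f' - f Φ'/Φ`. -/
theorem hasDerivAt_sq_mul_div_picone {Φ Φ' f : ℝ → ℝ} {Φ'' f' x : ℝ}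
    (hΦ : HasDerivAt Φ (Φ' x) x) (hΦ' : HasDerivAt Φ' Φ'' x) (hx : Φ x ≠ 0)
    (hf : HasDerivAt f f' x) :
    HasDerivAt (fun y => f y ^ 2 * (Φ' y / Φ y))
      (f' ^ 2 - f x ^ 2 * (-Φ'' / Φ x) - (f' - f x * Φ' x / Φ x) ^ 2) x := by
  refine ((hf.fun_pow 2).fun_mul (hΦ'.fun_div hΦ hx)).congr_deriv ?_
  push_cast
  field_simp
  ring

/-- **Boggio's inequality on a single edge (Dirichlet case).**  If `Φ` is a positive
`C²` function on `[a,b]` and `f` is `C¹` with `f(a) = f(b) = 0`, then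
`∫_a^b (f')² ≥ ∫_a^b f² (-Φ''/Φ)`. -/
theorem stmt_8 (a b : ℝ) (hab : a < b) (Φ Φ' Φ'' f f' : ℝ → ℝ)
    (hΦ : ∀ x ∈ Set.Icc a b, HasDerivAt Φ (Φ' x) x)
    (hΦ' : ∀ x ∈ Set.Icc a b, HasDerivAt Φ' (Φ'' x) x)
    (hΦ'' : ContinuousOn Φ'' (Set.Icc a b))
    (hΦpos : ∀ x ∈ Set.Icc a b, 0 < Φ x)
    (hf : ∀ x ∈ Set.Icc a b, HasDerivAt f (f' x) x)
    (hf' : ContinuousOn f' (Set.Icc a b))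
    (hfa : f a = 0) (hfb : f b = 0) :
    (∫ x in a..b, f' x ^ 2) ≥ ∫ x in a..b, f x ^ 2 * (-Φ'' x / Φ x) := by
  have cΦ : ContinuousOn Φ (Set.Icc a b) := fun x hx => (hΦ x hx).continuousAt.continuousWithinAt
  have cΦ' : ContinuousOn Φ' (Set.Icc a b) := fun x hx => (hΦ' x hx).continuousAt.continuousWithinAt
  have cf : ContinuousOn f (Set.Icc a b) := fun x hx => (hf x hx).continuousAt.continuousWithinAt
  have hne : ∀ x ∈ Set.Icc a b, Φ x ≠ 0 := fun x hx => (hΦpos x hx).ne'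
  have int_energy : IntervalIntegrable (fun x => f' x ^ 2) MeasureTheory.volume a b :=
    (hf'.pow 2).intervalIntegrable_of_Icc hab.le
  have int_potential :
      IntervalIntegrable (fun x => f x ^ 2 * (-Φ'' x / Φ x)) MeasureTheory.volume a b :=
    ((cf.pow 2).mul (hΦ''.neg.div cΦ hne)).intervalIntegrable_of_Icc hab.le
  have int_square :
      IntervalIntegrable (fun x => (f' x - f x * Φ' x / Φ x) ^ 2) MeasureTheory.volume a b :=
    ((hf'.sub ((cf.mul cΦ').div cΦ hne)).pow 2).intervalIntegrable_of_Icc hab.le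
  have ftc := intervalIntegral.integral_eq_sub_of_hasDerivAt
    (fun x hx => by
      rw [Set.uIcc_of_le hab.le] at hx
      exact hasDerivAt_sq_mul_div_picone (hΦ x hx) (hΦ' x hx) (hne x hx) (hf x hx))
    ((int_energy.sub int_potential).sub int_square)
  rw [intervalIntegral.integral_sub (int_energy.sub int_potential) int_square,
    intervalIntegral.integral_sub int_energy int_potential, hfa, hfb] at ftc
  have square_nonneg : 0 ≤ ∫ x in a..b, (f' x - f x * Φ' x / Φ x) ^ 2 :=
    intervalIntegral.integral_nonneg hab.le fun x _ => sq_nonneg _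
  linarith
end

section
/- Let U ⊆ ℝ be an open interval, let V : U → ℝ be continuous, let E ∈ ℝ, and let ψ : U → ℝ be twice continuously differentiable with ψ(x) > 0 and −ψ''(x) + (V(x) − E)ψ(x) ≥ 0 for all x ∈ U. Let η : ℝ → ℝ be continuously differentiable with compact support contained in U. Then ∫_U η(x)² ( ψ'(x)/ψ(x) )² dx ≤ 2 ∫_U η(x)² ( V(x) − E ) dx + 4 ∫_U η'(x)² dx. -/
open MeasureTheory

/-- A continuous compactly supported function times a function continuous on a neighbourhood of its
support is integrable. -/
lemma integrable_mul_of_tsupport_subset {U : Set ℝ} (hU : IsOpen U) {a h : ℝ → ℝ}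
    (ha : Continuous a) (hac : HasCompactSupport a) (haU : tsupport a ⊆ U)
    (hh : ContinuousOn h U) : Integrable (fun x => a x * h x) :=
  ((ha.continuousOn.mul hh).continuous_of_tsupport_subset hU
    ((tsupport_mul_subset_left (f := a) (g := h)).trans haU)).integrable_of_hasCompactSupport
    hac.mul_right

/-- The integral of the derivative of `a * h` vanishes when `a` is `C¹` with compact support in an
open set on which `h` is `C¹`. -/
lemma integral_deriv_mul_eq_zero_of_tsupport_subset {U : Set ℝ} (hU : IsOpen U)
    {a a' h h' : ℝ → ℝ} (ha : ∀ x, HasDerivAt a (a' x) x) (ha'c : Continuous a')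
    (hac : HasCompactSupport a) (haU : tsupport a ⊆ U)
    (hh : ∀ x ∈ U, HasDerivAt h (h' x) x) (hh'c : ContinuousOn h' U) :
    IntegrableOn (fun x => a' x * h x + a x * h' x) U ∧
      ∫ x in U, (a' x * h x + a x * h' x) = 0 := by
  have ha'eq : a' = deriv a := funext fun x => (ha x).deriv.symm
  have hacont : Continuous a := continuous_iff_continuousAt.2 fun x => (ha x).continuousAt
  have hhc : ContinuousOn h U := fun x hx => (hh x hx).continuousAt.continuousWithinAt
  have hsub : tsupport a' ⊆ tsupport a := ha'eq ▸ tsupport_deriv_subset (𝕜 := ℝ)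
  have hzero : ∀ x, x ∉ tsupport a → a' x * h x + a x * h' x = 0 := fun x hx => by
    rw [image_eq_zero_of_notMem_tsupport hx,
      image_eq_zero_of_notMem_tsupport fun hx' => hx (hsub hx')]
    ring
  have hint : Integrable (fun x => a' x * h x + a x * h' x) :=
    (integrable_mul_of_tsupport_subset hU ha'c (ha'eq ▸ hac.deriv) (hsub.trans haU) hhc).add
      (integrable_mul_of_tsupport_subset hU hacont hac haU hh'c)
  refine ⟨hint.integrableOn, ?_⟩
  rw [setIntegral_eq_integral_of_forall_compl_eq_zero fun x hx => hzero x fun h => hx (haU h)]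
  refine integral_eq_zero_of_hasDerivAt_of_integrable (f := fun x => a x * h x) (fun x => ?_) hint
    (integrable_mul_of_tsupport_subset hU hacont hac haU hhc)
  by_cases hx : x ∈ tsupport a
  · exact (ha x).mul (hh x (haU hx))
  · rw [hzero x hx]
    refine (hasDerivAt_const x (0 : ℝ)).congr_of_eventuallyEq ?_
    filter_upwards [(isClosed_tsupport a).isOpen_compl.mem_nhds hx] with y hy
    rw [image_eq_zero_of_notMem_tsupport hy, zero_mul]


/-- **Caccioppoli-type estimate (Harnack step).** Let `U` be an open interval, `V`
continuous on `U`, `ψ > 0` twice continuously differentiable on `U` with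
`-ψ'' + (V - E)ψ ≥ 0` on `U`, and let `η` be `C¹` with compact support contained
in `U`.  Then `∫_U η²(ψ'/ψ)² ≤ 2∫_U η²(V-E) + 4∫_U (η')²`. -/
theorem stmt_10
    (U : Set ℝ) (hU : IsOpen U) (hU' : U.OrdConnected)
    (V ψ ψ' ψ'' η : ℝ → ℝ) (E : ℝ)
    (hV : ContinuousOn V U)
    (hψd : ∀ x ∈ U, HasDerivAt ψ (ψ' x) x)
    (hψd' : ∀ x ∈ U, HasDerivAt ψ' (ψ'' x) x)
    (hψ''c : ContinuousOn ψ'' U)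
    (hpos : ∀ x ∈ U, 0 < ψ x)
    (hsuper : ∀ x ∈ U, 0 ≤ -ψ'' x + (V x - E) * ψ x)
    (hη : ContDiff ℝ 1 η) (hηsupp : HasCompactSupport η) (hηU : tsupport η ⊆ U) :
    (∫ x in U, η x ^ 2 * (ψ' x / ψ x) ^ 2) ≤
      2 * (∫ x in U, η x ^ 2 * (V x - E)) + 4 * ∫ x in U, deriv η x ^ 2 := by
  have hψc : ContinuousOn ψ U := fun x hx => (hψd x hx).continuousAt.continuousWithinAt
  have hψ'c : ContinuousOn ψ' U := fun x hx => (hψd' x hx).continuousAt.continuousWithinAt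
  have hne : ∀ x ∈ U, ψ x ≠ 0 := fun x hx => (hpos x hx).ne'
  have hgc : ContinuousOn (fun x => ψ' x / ψ x) U := hψ'c.div hψc hne
  have hη' : Continuous (deriv η) := hη.continuous_deriv le_rfl
  have hsq : (fun x => η x ^ 2) = fun x => η x * η x := funext fun x => sq _
  have hc2 : HasCompactSupport (fun x => η x ^ 2) := hsq ▸ hηsupp.mul_right
  have hs2 : tsupport (fun x => η x ^ 2) ⊆ U :=
    hsq ▸ (tsupport_mul_subset_left (f := η) (g := η)).trans hηU
  have hdη : ∀ x, HasDerivAt (fun x => η x ^ 2) (2 * η x * deriv η x) x := fun x => by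
    simpa using ((hη.differentiable one_ne_zero) x).hasDerivAt.fun_pow 2
  obtain ⟨hFi, hF⟩ := integral_deriv_mul_eq_zero_of_tsupport_subset hU hdη
    ((continuous_const.mul hη.continuous).mul hη') hc2 hs2
    (h := fun x => ψ' x / ψ x) (h' := fun x => ψ'' x / ψ x - (ψ' x / ψ x) ^ 2)
    (fun x hx => by
      refine ((hψd' x hx).fun_div (hψd x hx) (hne x hx)).congr_deriv ?_
      have := hne x hx
      field_simp)
    ((hψ''c.div hψc hne).sub (hgc.pow 2))
  have hi1 : IntegrableOn (fun x => η x ^ 2 * (ψ' x / ψ x) ^ 2) U :=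
    (integrable_mul_of_tsupport_subset hU (hη.continuous.pow 2) hc2 hs2
    (hgc.pow 2)).integrableOn (s := U)
  have hi2 : IntegrableOn (fun x => η x ^ 2 * (V x - E)) U :=
    (integrable_mul_of_tsupport_subset hU (hη.continuous.pow 2) hc2 hs2
    (hV.sub (continuousOn_const (c := E)))).integrableOn (s := U)
  have hi3 : IntegrableOn (fun x => deriv η x ^ 2) U := by
    simp only [sq]
    exact ((hη'.mul hη').integrable_of_hasCompactSupport hηsupp.deriv.mul_right).integrableOn
  have hmono := setIntegral_mono_on hi1
    (((hi2.const_mul 2).add (hi3.const_mul 4)).sub (hFi.const_mul 2)) hU.measurableSet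
    fun x hx => by
      have hle : ψ'' x / ψ x ≤ V x - E := by
        rw [div_le_iff₀ (hpos x hx)]
        linarith [hsuper x hx]
      simp only [Pi.add_apply, Pi.sub_apply]
      nlinarith [mul_le_mul_of_nonneg_left hle (sq_nonneg (η x)),
        sq_nonneg (η x * (ψ' x / ψ x) - 2 * deriv η x)]
  rw [integral_sub' ((hi2.const_mul 2).add (hi3.const_mul 4)) (hFi.const_mul 2),
    integral_add' (hi2.const_mul 2) (hi3.const_mul 4), integral_const_mul, integral_const_mul,
    integral_const_mul, hF] at hmono
  linarith
end

section
/- Let V : ℝ → ℝ be continuous, let E ∈ ℝ, and let ψ, η, F : ℝ → ℝ with ψ and η twice continuously differentiable and F continuously differentiable on an interval I. Suppose −ψ''(x) + (V(x) − E)ψ(x) = 0 for all x ∈ I. Then for all x ∈ I, F(x)² η(x) ψ(x) · ( −(ηψ)''(x) + (V(x) − E) η(x)ψ(x) ) = ψ(x)² · η'(x) · ( η F² )'(x) − G'(x), where G(x) := η(x) η'(x) F(x)² ψ(x)². -/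
/-- **First pointwise Agmon identity.** Let `ψ`, `η` be twice continuously
differentiable and `F` continuously differentiable on an (open) interval `I`, and
suppose `-ψ'' + (V - E)ψ = 0` on `I`.  Then for all `x ∈ I`,
`F² ηψ (-(ηψ)'' + (V-E)ηψ) = ψ² η' (ηF²)' - G'`, where `G = η η' F² ψ²`. -/
theorem stmt_11
    (I : Set ℝ) (hI : IsOpen I) (hI' : I.OrdConnected)
    (V ψ ψ' ψ'' η η' η'' F F' : ℝ → ℝ) (E : ℝ)
    (hV : Continuous V)
    (hψd : ∀ x ∈ I, HasDerivAt ψ (ψ' x) x)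
    (hψd' : ∀ x ∈ I, HasDerivAt ψ' (ψ'' x) x)
    (hψc : ContinuousOn ψ'' I)
    (hηd : ∀ x ∈ I, HasDerivAt η (η' x) x)
    (hηd' : ∀ x ∈ I, HasDerivAt η' (η'' x) x)
    (hηc : ContinuousOn η'' I)
    (hFd : ∀ x ∈ I, HasDerivAt F (F' x) x)
    (hFc : ContinuousOn F' I)
    (heq : ∀ x ∈ I, -ψ'' x + (V x - E) * ψ x = 0) :
    ∀ x ∈ I,
      F x ^ 2 * η x * ψ x *
          (-(deriv (deriv fun y => η y * ψ y) x) + (V x - E) * (η x * ψ x)) =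
        ψ x ^ 2 * η' x * deriv (fun y => η y * F y ^ 2) x -
          deriv (fun y => η y * η' y * F y ^ 2 * ψ y ^ 2) x := by
  intro x hx
  have hprod : deriv (fun y => η y * ψ y) =ᶠ[nhds x] fun y => η' y * ψ y + η y * ψ' y := by
    filter_upwards [hI.mem_nhds hx] with y hy
    exact ((hηd y hy).fun_mul (hψd y hy)).deriv
  have hψ := hψd x hx
  have hη := hηd x hx
  have hη' := hηd' x hx
  have hF2 := (hFd x hx).fun_pow 2
  rw [hprod.deriv_eq, ((hη'.fun_mul hψ).fun_add (hη.fun_mul (hψd' x hx))).deriv,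
    (hη.fun_mul hF2).deriv,
    (((hη.fun_mul hη').fun_mul hF2).fun_mul (hψ.fun_pow 2)).deriv]
  push_cast
  linear_combination F x ^ 2 * η x ^ 2 * ψ x * heq x hx
end

section
/- Let V : ℝ → ℝ be continuous, let E ∈ ℝ, let u : ℝ → ℝ be twice continuously differentiable and F : ℝ → ℝ continuously differentiable with F(x) > 0 on an interval I. Then for all x ∈ I, F(x)² u(x) ( −u''(x) + (V(x) − E) u(x) ) = ( (F u)'(x) )² + ( V(x) − E − ( F'(x)/F(x) )² ) ( F(x) u(x) )² − Hₓ'(x), where Hₓ(x) := F(x)² u(x) u'(x). -/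
/-- **Second pointwise Agmon identity.** Let `u` be twice continuously differentiable
and `F > 0` continuously differentiable on an (open) interval `I`.  Then for all
`x ∈ I`,
`F² u (-u'' + (V-E)u) = ((Fu)')² + (V - E - (F'/F)²)(Fu)² - H'`,
where `H = F² u u'`. -/
theorem stmt_12
    (I : Set ℝ) (hI : IsOpen I) (hI' : I.OrdConnected)
    (V u u' u'' F F' : ℝ → ℝ) (E : ℝ)
    (hV : Continuous V)
    (hud : ∀ x ∈ I, HasDerivAt u (u' x) x)
    (hud' : ∀ x ∈ I, HasDerivAt u' (u'' x) x)
    (huc : ContinuousOn u'' I)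
    (hFd : ∀ x ∈ I, HasDerivAt F (F' x) x)
    (hFc : ContinuousOn F' I)
    (hFpos : ∀ x ∈ I, 0 < F x) :
    ∀ x ∈ I,
      F x ^ 2 * u x * (-u'' x + (V x - E) * u x) =
        (deriv (fun y => F y * u y) x) ^ 2 +
          (V x - E - (F' x / F x) ^ 2) * (F x * u x) ^ 2 -
          deriv (fun y => F y ^ 2 * u y * u' y) x := by
  intro x hx
  have hF : F x ≠ 0 := (hFpos x hx).ne'
  have hFu : HasDerivAt (fun y => F y * u y) (F' x * u x + F x * u' x) x :=
    (hFd x hx).mul (hud x hx)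
  have hH : HasDerivAt (fun y => F y ^ 2 * u y * u' y) _ x :=
    (((hFd x hx).fun_pow 2).mul (hud x hx)).mul (hud' x hx)
  rw [hFu.deriv, hH.deriv]
  simp only [Pi.mul_apply]
  field_simp
  push_cast
  ring
end

section
/- Let V : ℝ → ℝ be continuous, let E ∈ ℝ, let I ⊆ ℝ be an open interval, let ψ : ℝ → ℝ satisfy the Schrödinger equation with potential V and energy E on I, let η : ℝ → ℝ be twice continuously differentiable with compact support contained in I, and let F : ℝ → ℝ be continuously differentiable with F > 0 on I. Then ∫ ψ(x)² η'(x) (η F²)'(x) dx = ∫ ( (F η ψ)'(x) )² dx + ∫ ( V(x) − E − (F'(x)/F(x))² ) ( F(x) η(x) ψ(x) )² dx. In particular, if additionally (F'(x)/F(x))² ≤ V(x) − E for all x in the support of η, then ∫ ( (F η ψ)'(x) )² dx ≤ ∫ ψ(x)² η'(x) (η F²)'(x) dx. -/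
open MeasureTheory

/-- A function that is continuous on an open set and vanishes off a compact subset of it is
integrable. -/
theorem integrable_of_continuousOn_of_eq_zero_off_compact {I K : Set ℝ} (hI : IsOpen I)
    (hK : IsCompact K) (hKI : K ⊆ I) {g : ℝ → ℝ} (hg : ContinuousOn g I)
    (h0 : ∀ x ∉ K, g x = 0) : Integrable g := by
  have hsub : tsupport g ⊆ K :=
    closure_minimal (fun x hx => by_contra fun hxK => hx (h0 x hxK)) hK.isClosed
  exact (hg.continuous_of_tsupport_subset hI (hsub.trans hKI)).integrable_of_hasCompactSupport
    (HasCompactSupport.intro hK h0)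

/-- A function that vanishes wherever `η` does has derivative zero off the topological support
of `η`. -/
theorem hasDerivAt_zero_of_notMem_tsupport {η g : ℝ → ℝ} (h : ∀ y, η y = 0 → g y = 0) {x : ℝ}
    (hx : x ∉ tsupport η) : HasDerivAt g 0 x := by
  have hη : η =ᶠ[nhds x] 0 := notMem_tsupport_iff_eventuallyEq.mp hx
  exact (hasDerivAt_const x (0 : ℝ)).congr_of_eventuallyEq (hη.mono fun y hy => h y hy)

/-- **Integrated Agmon identity.** Let `ψ` satisfy the Schrödinger equation
`-ψ'' + Vψ = Eψ` on an open interval `I`, let `η` be `C²` with compact support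
contained in `I`, and let `F > 0` be continuously differentiable on `I`.  Then
`∫ ψ² η' (ηF²)' = ∫ ((Fηψ)')² + ∫ (V - E - (F'/F)²)(Fηψ)²`; in particular if
`(F'/F)² ≤ V - E` on the support of `η`, then `∫ ((Fηψ)')² ≤ ∫ ψ² η' (ηF²)'`. -/
theorem stmt_13
    (I : Set ℝ) (hI : IsOpen I) (hI' : I.OrdConnected)
    (V ψ ψ' ψ'' η η' F F' : ℝ → ℝ) (E : ℝ)
    (hV : Continuous V)
    (hψd : ∀ x ∈ I, HasDerivAt ψ (ψ' x) x)
    (hψd' : ∀ x ∈ I, HasDerivAt ψ' (ψ'' x) x)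
    (hψc : ContinuousOn ψ'' I)
    (heq : ∀ x ∈ I, -ψ'' x + V x * ψ x = E * ψ x)
    (hη : ContDiff ℝ 2 η)
    (hηd : ∀ x, HasDerivAt η (η' x) x)
    (hηsupp : HasCompactSupport η) (hηI : tsupport η ⊆ I)
    (hFd : ∀ x ∈ I, HasDerivAt F (F' x) x)
    (hFc : ContinuousOn F' I)
    (hFpos : ∀ x ∈ I, 0 < F x) :
    (∫ x, ψ x ^ 2 * η' x * deriv (fun y => η y * F y ^ 2) x) =
        (∫ x, (deriv (fun y => F y * η y * ψ y) x) ^ 2) +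
          ∫ x, (V x - E - (F' x / F x) ^ 2) * (F x * η x * ψ x) ^ 2 ∧
      ((∀ x ∈ tsupport η, (F' x / F x) ^ 2 ≤ V x - E) →
        (∫ x, (deriv (fun y => F y * η y * ψ y) x) ^ 2) ≤
          ∫ x, ψ x ^ 2 * η' x * deriv (fun y => η y * F y ^ 2) x) := by
  have hη0 : ∀ x ∉ tsupport η, η x = 0 := fun x hx => image_eq_zero_of_notMem_tsupport hx
  have hη'0 : ∀ x ∉ tsupport η, η' x = 0 := fun x hx =>
    (hηd x).unique (hasDerivAt_zero_of_notMem_tsupport (fun _ h => h) hx)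
  have cη : ContinuousOn η I := hη.continuous.continuousOn
  have cη' : ContinuousOn η' I := by
    have h : η' = deriv η := funext fun x => (hηd x).deriv.symm
    rw [h]
    exact (hη.continuous_deriv (by norm_num)).continuousOn
  have cψ : ContinuousOn ψ I := fun x hx => (hψd x hx).continuousAt.continuousWithinAt
  have cψ' : ContinuousOn ψ' I := fun x hx => (hψd' x hx).continuousAt.continuousWithinAt
  have cF : ContinuousOn F I := fun x hx => (hFd x hx).continuousAt.continuousWithinAt
  have cV : ContinuousOn V I := hV.continuousOn
  have hF0 : ∀ x ∈ I, F x ≠ 0 := fun x hx => (hFpos x hx).ne'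
  have dA : ∀ x, deriv (fun y => η y * F y ^ 2) x
      = η' x * F x ^ 2 + η x * (2 * F x * F' x) := by
    intro x
    by_cases hx : x ∈ tsupport η
    · refine (((hηd x).mul ((hFd x (hηI hx)).pow 2)).congr_deriv ?_).deriv
      simp
    · rw [(hasDerivAt_zero_of_notMem_tsupport (η := η) (fun y hy => by simp [hy]) hx).deriv]
      simp [hη0 x hx, hη'0 x hx]
  have dB : ∀ x, deriv (fun y => F y * η y * ψ y) x
      = (F' x * η x + F x * η' x) * ψ x + F x * η x * ψ' x := by
    intro x
    by_cases hx : x ∈ tsupport η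
    · exact (((hFd x (hηI hx)).mul (hηd x)).mul (hψd x (hηI hx))).deriv
    · rw [(hasDerivAt_zero_of_notMem_tsupport (η := η) (fun y hy => by simp [hy]) hx).deriv]
      simp [hη0 x hx, hη'0 x hx]
  simp only [dA, dB]
  set A : ℝ → ℝ := fun x => ψ x ^ 2 * η' x * (η' x * F x ^ 2 + η x * (2 * F x * F' x)) with hA
  set B : ℝ → ℝ := fun x => ((F' x * η x + F x * η' x) * ψ x + F x * η x * ψ' x) ^ 2 with hB
  set C : ℝ → ℝ := fun x => (V x - E - (F' x / F x) ^ 2) * (F x * η x * ψ x) ^ 2 with hC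
  set G : ℝ → ℝ := fun x => (F x * η x) ^ 2 * (ψ x * ψ' x) with hG
  have iA : Integrable A := by
    refine integrable_of_continuousOn_of_eq_zero_off_compact hI hηsupp hηI ?_
      (fun x hx => by simp [hA, hη'0 x hx])
    fun_prop
  have iB : Integrable B := by
    refine integrable_of_continuousOn_of_eq_zero_off_compact hI hηsupp hηI ?_
      (fun x hx => by simp [hB, hη0 x hx, hη'0 x hx])
    fun_prop
  have iC : Integrable C := by
    refine integrable_of_continuousOn_of_eq_zero_off_compact hI hηsupp hηI ?_
      (fun x hx => by simp [hC, hη0 x hx])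
    have cQ : ContinuousOn (fun x => F' x / F x) I := hFc.div cF hF0
    fun_prop
  have iG : Integrable G := by
    refine integrable_of_continuousOn_of_eq_zero_off_compact hI hηsupp hηI ?_
      (fun x hx => by simp [hG, hη0 x hx])
    fun_prop
  have dG : ∀ x, HasDerivAt G (B x + C x - A x) x := by
    intro x
    by_cases hx : x ∈ tsupport η
    · have hxI := hηI hx
      refine ((((hFd x hxI).mul (hηd x)).pow 2).mul
        ((hψd x hxI).mul (hψd' x hxI))).congr_deriv ?_
      have hψ'' : ψ'' x = (V x - E) * ψ x := by linear_combination -heq x hxI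
      have hF := hF0 x hxI
      simp only [hA, hB, hC, hψ'', Pi.mul_apply, Pi.pow_apply]
      field_simp
      norm_num
      ring
    · have h0 : B x + C x - A x = 0 := by simp [hA, hB, hC, hη0 x hx, hη'0 x hx]
      rw [h0]
      exact hasDerivAt_zero_of_notMem_tsupport (η := η) (fun y hy => by simp [hG, hy]) hx
  have key : ∫ x, A x = (∫ x, B x) + ∫ x, C x := by
    have h := integral_eq_zero_of_hasDerivAt_of_integrable dG ((iB.add iC).sub iA) iG
    have hsub : ∫ x, B x + C x - A x = (∫ x, B x + C x) - ∫ x, A x :=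
      integral_sub (iB.add iC) iA
    rw [hsub, integral_add iB iC] at h
    linarith
  refine ⟨key, fun hle => ?_⟩
  have hCnn : 0 ≤ ∫ x, C x := by
    refine integral_nonneg fun x => ?_
    by_cases hx : x ∈ tsupport η
    · exact mul_nonneg (sub_nonneg.mpr (hle x hx)) (sq_nonneg _)
    · simp [hC, hη0 x hx]
  linarith
end

section
/- Let α < β and let u : [α,β] → ℝ be continuously differentiable with u(α) = u(β) = 0. Then for every x ∈ (α,β), u(x)² ≤ ( (x−α)(β−x) / (β−α) ) · ∫_α^β u'(t)² dt. -/
open MeasureTheory in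
/-- Cauchy–Schwarz inequality against the constant function `1` on a compact interval. -/
theorem sq_intervalIntegral_le {a b : ℝ} (hab : a ≤ b) {f : ℝ → ℝ}
    (hf : IntervalIntegrable f volume a b)
    (hf2 : IntervalIntegrable (fun t => f t ^ 2) volume a b) :
    (∫ t in a..b, f t) ^ 2 ≤ (b - a) * ∫ t in a..b, f t ^ 2 := by
  rcases hab.eq_or_lt with rfl | hlt
  · simp
  have hpos : 0 < b - a := sub_pos.2 hlt
  set S := ∫ t in a..b, f t with hS
  have key : 0 ≤ ∫ t in a..b, ((b - a) * f t - S) ^ 2 :=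
    intervalIntegral.integral_nonneg hab fun t _ => sq_nonneg _
  have expand : ∫ t in a..b, ((b - a) * f t - S) ^ 2
      = (b - a) ^ 2 * (∫ t in a..b, f t ^ 2) - 2 * (b - a) * S * S + (b - a) * S ^ 2 := by
    have h : ∀ t, ((b - a) * f t - S) ^ 2
        = (b - a) ^ 2 * f t ^ 2 - 2 * (b - a) * S * f t + S ^ 2 := fun t => by ring
    simp_rw [h]
    rw [intervalIntegral.integral_add ((hf2.const_mul _).sub (hf.const_mul _))
        intervalIntegrable_const,
      intervalIntegral.integral_sub (hf2.const_mul _) (hf.const_mul _),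
      intervalIntegral.integral_const_mul, intervalIntegral.integral_const_mul,
      intervalIntegral.integral_const, ← hS, smul_eq_mul]
  rw [expand] at key
  refine le_of_mul_le_mul_left ?_ hpos
  linarith

/-- An increment of a `C¹` function is controlled by the `L²` norm of its derivative. -/
theorem sq_sub_le_mul_integral_sq_deriv {a b : ℝ} (hab : a ≤ b) {u u' : ℝ → ℝ}
    (hu : ∀ x ∈ Set.Icc a b, HasDerivAt u (u' x) x) (hu' : ContinuousOn u' (Set.Icc a b)) :
    (u b - u a) ^ 2 ≤ (b - a) * ∫ t in a..b, u' t ^ 2 := by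
  have hint := hu'.intervalIntegrable_of_Icc (μ := MeasureTheory.volume) hab
  rw [← intervalIntegral.integral_eq_sub_of_hasDerivAt
    (fun x hx => hu x (by rwa [Set.uIcc_of_le hab] at hx)) hint]
  exact sq_intervalIntegral_le hab hint ((hu'.pow 2).intervalIntegrable_of_Icc hab)

/-- **Cauchy–Schwarz step of the Agmon pointwise bound.** If `u` is continuously
differentiable on `[α,β]` with `u(α) = u(β) = 0`, then for every `x ∈ (α,β)`,
`u(x)² ≤ ((x-α)(β-x)/(β-α)) ∫_α^β (u')²`. -/
theorem stmt_14 (α β : ℝ) (hab : α < β) (u u' : ℝ → ℝ)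
    (hu : ∀ x ∈ Set.Icc α β, HasDerivAt u (u' x) x)
    (hu' : ContinuousOn u' (Set.Icc α β))
    (ha : u α = 0) (hb : u β = 0) :
    ∀ x ∈ Set.Ioo α β,
      u x ^ 2 ≤ ((x - α) * (β - x) / (β - α)) * ∫ t in α..β, u' t ^ 2 := by
  rintro x ⟨hαx, hxβ⟩
  have hl : Set.Icc α x ⊆ Set.Icc α β := Set.Icc_subset_Icc_right hxβ.le
  have hr : Set.Icc x β ⊆ Set.Icc α β := Set.Icc_subset_Icc_left hαx.le
  have left := sq_sub_le_mul_integral_sq_deriv hαx.le (fun y hy => hu y (hl hy)) (hu'.mono hl)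
  have right := sq_sub_le_mul_integral_sq_deriv hxβ.le (fun y hy => hu y (hr hy)) (hu'.mono hr)
  rw [ha, sub_zero] at left
  rw [hb, zero_sub, neg_sq] at right
  rw [← intervalIntegral.integral_add_adjacent_intervals (f := fun t => u' t ^ 2)
      (((hu'.mono hl).pow 2).intervalIntegrable_of_Icc hαx.le)
      (((hu'.mono hr).pow 2).intervalIntegrable_of_Icc hxβ.le),
    div_mul_eq_mul_div, le_div_iff₀ (sub_pos.2 hab)]
  have h₁ := mul_le_mul_of_nonneg_left left (sub_nonneg.2 hxβ.le)
  have h₂ := mul_le_mul_of_nonneg_left right (sub_nonneg.2 hαx.le)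
  linarith
end

section
/- Let L > 0 and let f : [0,L] → ℝ be continuous, concave, and nonnegative. Then ∫_0^L f(x)² dx ≥ (L/3) · ( sup_{x ∈ [0,L]} f(x) )². -/
/-- A concave function lies above its chord. -/
lemma ConcaveOn.chord_le {a b : ℝ} (hab : a < b) {f : ℝ → ℝ}
    (hf : ConcaveOn ℝ (Set.Icc a b) f) {x : ℝ} (hx : x ∈ Set.Icc a b) :
    f a + (f b - f a) / (b - a) * (x - a) ≤ f x := by
  have hpos : 0 < b - a := sub_pos.2 hab
  have h := hf.2 (Set.left_mem_Icc.2 hab.le) (Set.right_mem_Icc.2 hab.le)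
    (div_nonneg (sub_nonneg.2 hx.2) hpos.le) (div_nonneg (sub_nonneg.2 hx.1) hpos.le)
    (by field_simp; ring)
  simp only [smul_eq_mul] at h
  have hx' : (b - x) / (b - a) * a + (x - a) / (b - a) * b = x := by
    field_simp
    ring
  have hchord : (b - x) / (b - a) * f a + (x - a) / (b - a) * f b =
      f a + (f b - f a) / (b - a) * (x - a) := by
    field_simp
    ring
  rwa [hx', hchord] at h

lemma integral_affine_sq (a b c s : ℝ) :
    ∫ x in a..b, (c + s * (x - a)) ^ 2 =
      (b - a) / 3 * (c ^ 2 + c * (c + s * (b - a)) + (c + s * (b - a)) ^ 2) := by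
  have hderiv (x : ℝ) : HasDerivAt
      (fun x : ℝ => c ^ 2 * x + c * s * (x - a) ^ 2 + s ^ 2 / 3 * (x - a) ^ 3)
      ((c + s * (x - a)) ^ 2) x := by
    have hid := (hasDerivAt_id x).sub_const a
    refine ((((hasDerivAt_id x).const_mul (c ^ 2)).add ((hid.pow 2).const_mul (c * s))).add
      ((hid.pow 3).const_mul (s ^ 2 / 3))).congr_deriv ?_
    simp only [id]
    push_cast
    ring
  rw [intervalIntegral.integral_eq_sub_of_hasDerivAt (fun x _ => hderiv x)
    (Continuous.intervalIntegrable (by fun_prop) _ _)]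
  ring

/-- The square integral of a nonnegative concave function dominates that of its chord. -/
lemma ConcaveOn.chord_sq_le_integral_sq {a b : ℝ} (hab : a ≤ b) {f : ℝ → ℝ}
    (hc : ContinuousOn f (Set.Icc a b)) (hf : ConcaveOn ℝ (Set.Icc a b) f)
    (ha : 0 ≤ f a) (hb : 0 ≤ f b) :
    (b - a) / 3 * (f a ^ 2 + f a * f b + f b ^ 2) ≤ ∫ x in a..b, f x ^ 2 := by
  obtain rfl | hab := hab.eq_or_lt
  · simp
  have hpos : 0 < b - a := sub_pos.2 hab
  have hint := integral_affine_sq a b (f a) ((f b - f a) / (b - a))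
  rw [div_mul_cancel₀ _ hpos.ne', add_sub_cancel] at hint
  rw [← hint]
  refine intervalIntegral.integral_mono_on hab.le
    (Continuous.intervalIntegrable (by fun_prop) _ _)
    (ContinuousOn.intervalIntegrable (by rw [Set.uIcc_of_le hab.le]; exact hc.pow 2))
    fun x hx => pow_le_pow_left₀ ?_ (hf.chord_le hab hx) 2
  have hchord : f a + (f b - f a) / (b - a) * (x - a) =
      (f a * (b - x) + f b * (x - a)) / (b - a) := by
    field_simp
    ring
  rw [hchord]
  exact div_nonneg (add_nonneg (mul_nonneg ha (sub_nonneg.2 hx.2))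
    (mul_nonneg hb (sub_nonneg.2 hx.1))) hpos.le

/-- **L² vs L∞ for concave functions.** If `f` is continuous, concave, and
nonnegative on `[0,L]` with `L > 0`, then `∫_0^L f² ≥ (L/3)(sup_{[0,L]} f)²`. -/
theorem stmt_16 (L : ℝ) (hL : 0 < L) (f : ℝ → ℝ)
    (hc : ContinuousOn f (Set.Icc 0 L))
    (hconc : ConcaveOn ℝ (Set.Icc 0 L) f)
    (hnn : ∀ x ∈ Set.Icc 0 L, 0 ≤ f x) :
    (∫ x in (0:ℝ)..L, f x ^ 2) ≥ (L / 3) * (sSup (f '' Set.Icc 0 L)) ^ 2 := by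
  obtain ⟨c, hcm, hsup, -⟩ :=
    isCompact_Icc.exists_sSup_image_eq_and_ge (Set.nonempty_Icc.2 hL.le) hc
  rw [hsup]
  have hl : Set.Icc 0 c ⊆ Set.Icc 0 L := Set.Icc_subset_Icc_right hcm.2
  have hr : Set.Icc c L ⊆ Set.Icc 0 L := Set.Icc_subset_Icc_left hcm.1
  have h0 := hnn 0 (Set.left_mem_Icc.2 hL.le)
  have h1 := hnn L (Set.right_mem_Icc.2 hL.le)
  have hfc := hnn c hcm
  have hleft := (hconc.subset hl (convex_Icc _ _)).chord_sq_le_integral_sq hcm.1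
    (hc.mono hl) h0 hfc
  have hright := (hconc.subset hr (convex_Icc _ _)).chord_sq_le_integral_sq hcm.2
    (hc.mono hr) hfc h1
  have hsplit : (∫ x in (0 : ℝ)..c, f x ^ 2) + ∫ x in c..L, f x ^ 2 =
      ∫ x in (0 : ℝ)..L, f x ^ 2 :=
    intervalIntegral.integral_add_adjacent_intervals
      (ContinuousOn.intervalIntegrable
        (by rw [Set.uIcc_of_le hcm.1]; exact (hc.mono hl).pow 2))
      (ContinuousOn.intervalIntegrable
        (by rw [Set.uIcc_of_le hcm.2]; exact (hc.mono hr).pow 2))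
  have hl' : 0 ≤ (c - 0) / 3 * (f 0 ^ 2 + f 0 * f c) :=
    mul_nonneg (by linarith [hcm.1]) (by positivity)
  have hr' : 0 ≤ (L - c) / 3 * (f c * f L + f L ^ 2) :=
    mul_nonneg (by linarith [hcm.2]) (by positivity)
  linarith
end

section
/- Let b > 0 and V₁ ≥ 0, let I ⊆ ℝ, and let V : ℝ → ℝ satisfy V(x) ≥ V₁ + b² x² for all x ∈ I. Define Υ₀(x) := (1/(b + V₁/2)) · ( 1/2 + e^{−b x²/2} ). Then for every x ∈ I, −Υ₀''(x) + V(x) Υ₀(x) ≥ 1. -/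
theorem hasDerivAt_gaussian_exponent (b x : ℝ) :
    HasDerivAt (fun y : ℝ => -b * y ^ 2 / 2) (-b * x) x := by
  have h := ((hasDerivAt_pow 2 x).const_mul (-b)).div_const 2
  refine h.congr_deriv ?_
  norm_num
  ring

/-- The first derivative of a scaled and shifted Gaussian. -/
theorem deriv_const_mul_add_gaussian (A c b : ℝ) :
    deriv (fun y : ℝ => A * (c + Real.exp (-b * y ^ 2 / 2))) =
      fun y => A * (Real.exp (-b * y ^ 2 / 2) * (-b * y)) := by
  funext y
  have h := hasDerivAt_gaussian_exponent b y
  exact ((h.exp.const_add c).const_mul A).deriv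

/-- The second derivative of a scaled and shifted Gaussian. -/
theorem deriv_deriv_const_mul_add_gaussian (A c b x : ℝ) :
    deriv (deriv fun y : ℝ => A * (c + Real.exp (-b * y ^ 2 / 2))) x =
      A * ((b ^ 2 * x ^ 2 - b) * Real.exp (-b * x ^ 2 / 2)) := by
  rw [deriv_const_mul_add_gaussian]
  have h := hasDerivAt_gaussian_exponent b x
  have h' : HasDerivAt (fun y : ℝ => -b * y) (-b) x := by
    simpa using (hasDerivAt_id x).const_mul (-b)
  refine ((h.exp.mul h').const_mul A).deriv.trans ?_
  ring

/-- **Explicit simplified torsion (landscape) function.** Let `b > 0`, `V₁ ≥ 0`, and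
suppose `V(x) ≥ V₁ + b²x²` on `I`.  Then
`Υ₀(x) = (1/(b + V₁/2))(1/2 + e^{-bx²/2})` satisfies `-Υ₀'' + V·Υ₀ ≥ 1` on `I`. -/
theorem stmt_18 (b V₁ : ℝ) (hb : 0 < b) (hV₁ : 0 ≤ V₁)
    (I : Set ℝ) (V : ℝ → ℝ)
    (hV : ∀ x ∈ I, V₁ + b ^ 2 * x ^ 2 ≤ V x) :
    ∀ x ∈ I,
      -(deriv (deriv fun y : ℝ =>
          (1 / (b + V₁ / 2)) * (1 / 2 + Real.exp (-b * y ^ 2 / 2))) x) +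
        V x * ((1 / (b + V₁ / 2)) * (1 / 2 + Real.exp (-b * x ^ 2 / 2))) ≥ 1 := by
  intro x hx
  rw [deriv_deriv_const_mul_add_gaussian]
  have hE := Real.add_one_le_exp (-b * x ^ 2 / 2)
  have hE₀ := Real.exp_pos (-b * x ^ 2 / 2)
  set E := Real.exp (-b * x ^ 2 / 2)
  have hA : 0 < b + V₁ / 2 := by positivity
  have hVE : (V₁ + b ^ 2 * x ^ 2) * (1 / 2 + E) ≤ V x * (1 / 2 + E) :=
    mul_le_mul_of_nonneg_right (hV x hx) (by positivity)
  have hbE : b * (-b * x ^ 2 / 2 + 1) ≤ b * E := mul_le_mul_of_nonneg_left hE hb.le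
  have hVE₀ : 0 ≤ V₁ * E := by positivity
  calc (1 : ℝ) ≤ (-((b ^ 2 * x ^ 2 - b) * E) + V x * (1 / 2 + E)) / (b + V₁ / 2) := by
        rw [one_le_div hA]
        linarith
    _ = _ := by ring
end

section
/- Let b > 0 and V₁ ≥ 0. Then for every x ∈ ℝ, (V₁ + b² x²)/2 + (b + V₁) e^{−b x²/2} ≥ V₁/2 + b + b · log( (b + V₁)/b ). -/
/-- **Sharp constant in the Gaussian landscape construction.** For `b > 0` and
`V₁ ≥ 0`, the function `f(x) = (V₁ + b²x²)/2 + (b + V₁)e^{-bx²/2}` satisfies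
`f(x) ≥ V₁/2 + b + b·log((b+V₁)/b)` for every real `x`. -/
theorem stmt_19 (b V₁ : ℝ) (hb : 0 < b) (hV₁ : 0 ≤ V₁) :
    ∀ x : ℝ,
      (V₁ + b ^ 2 * x ^ 2) / 2 + (b + V₁) * Real.exp (-b * x ^ 2 / 2) ≥
        V₁ / 2 + b + b * Real.log ((b + V₁) / b) := by
  intro x
  have hc : 0 < (b + V₁) / b := by positivity
  have key := Real.add_one_le_exp (Real.log ((b + V₁) / b) + -b * x ^ 2 / 2)
  rw [Real.exp_add, Real.exp_log hc] at key
  have scaled := mul_le_mul_of_nonneg_left key hb.le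
  rw [← mul_assoc, mul_div_cancel₀ (b + V₁) hb.ne'] at scaled
  linarith
end
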